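/- With g_1(p) = (1/q)·((1-2pq)/(q^2·(1 - ln(q)·√(2/p)·(1 + √(p/2)))))^(√(p/2)) and q = 1-p, one has ln g_1(p) = (1/3)p² + O(p^(5/2)) as p → 0⁺; in particular g_1(p) > 1 for all sufficiently small p > 0. -/

import Mathlib

open Asymptotics Filter

lemma aux_log (n : ℕ) (x : ℝ) (hx : |x| ≤ 1 / 2) :
    ∃ a : ℝ, |a| ≤ 2 ∧
      Real.log (1 - x) = -(∑ i ∈ Finset.range n, x ^ (i + 1) / ((i : ℝ) + 1)) + a * x ^ (n + 1) := by
  have h := Real.abs_log_sub_add_sum_range_le (x := x) (by linarith) n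
  have h2 : |x| ^ (n + 1) / (1 - |x|) ≤ 2 * |x| ^ (n + 1) := by
    rw [div_le_iff₀ (by linarith)]
    have : 0 ≤ |x| ^ (n + 1) := by positivity
    nlinarith
  have h3 := h.trans h2
  by_cases hx0 : x = 0
  · subst hx0
    exact ⟨0, by simp, by simp⟩
  · have hp : 0 < |x| ^ (n + 1) := by positivity
    refine ⟨(∑ i ∈ Finset.range n, x ^ (i + 1) / ((i : ℝ) + 1) + Real.log (1 - x)) / x ^ (n + 1),
      ?_, ?_⟩
    · rw [abs_div, abs_pow, div_le_iff₀ hp]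
      exact h3
    · field_simp
      ring

/-- The explicit remainder polynomial. -/
noncomputable def auxR (s a b c : ℝ) : ℝ :=
  let v := 2 - a * s * (1 + s)
  let t := 2 + s * v
  let r := 2 + s * t
  let w := 2 + s * r
  let E2 := 4 + 4 * t * (1 + s) + s ^ 2 * t ^ 2
  let E3 := 12 * r + 6 * s * r ^ 2 + s ^ 2 * r ^ 3
  let Q := v - E2 / 2 + E3 / 3 + b * w ^ 4
  12 - a * s + 16 * c * (1 - 2 * s ^ 2) ^ 2 - 2 * a * s ^ 2 - Q

lemma auxR_bdd : ∃ M : ℝ, 0 < M ∧ ∀ s a b c : ℝ, |s| ≤ 1 → |a| ≤ 16 → |b| ≤ 2 → |c| ≤ 2 →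
    |auxR s a b c| ≤ M := by
  have hc : IsCompact (Set.Icc (-1 : ℝ) 1 ×ˢ Set.Icc (-16 : ℝ) 16 ×ˢ Set.Icc (-2 : ℝ) 2 ×ˢ
      Set.Icc (-2 : ℝ) 2) :=
    isCompact_Icc.prod (isCompact_Icc.prod (isCompact_Icc.prod isCompact_Icc))
  have hf : Continuous (fun z : ℝ × ℝ × ℝ × ℝ => auxR z.1 z.2.1 z.2.2.1 z.2.2.2) := by
    unfold auxR
    fun_prop
  obtain ⟨M, hM⟩ := hc.exists_bound_of_continuousOn hf.continuousOn
  refine ⟨max M 1, by positivity, fun s a b c hs ha hb hc => ?_⟩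
  have := hM (s, a, b, c) ⟨abs_le.mp hs, abs_le.mp ha, abs_le.mp hb, abs_le.mp hc⟩
  exact this.trans (le_max_left _ _)

lemma aux_core (s : ℝ) (hs : 0 < s) (hs1 : s ≤ 1 / 10) :
    ∃ a b c : ℝ, |a| ≤ 16 ∧ |b| ≤ 2 ∧ |c| ≤ 2 ∧
      0 < (1 / (1 - 2 * s ^ 2)) * ((1 - 2 * (2 * s ^ 2) * (1 - 2 * s ^ 2)) /
        ((1 - 2 * s ^ 2) ^ (2:ℕ) * (1 - Real.log (1 - 2 * s ^ 2) * (1 / s) * (1 + s)))) ^ s ∧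
      Real.log ((1 / (1 - 2 * s ^ 2)) * ((1 - 2 * (2 * s ^ 2) * (1 - 2 * s ^ 2)) /
        ((1 - 2 * s ^ 2) ^ (2:ℕ) * (1 - Real.log (1 - 2 * s ^ 2) * (1 / s) * (1 + s)))) ^ s)
        = 4 / 3 * s ^ 4 + s ^ 5 * auxR s a b c := by
  have hs2 : s ^ 2 ≤ 1 / 100 := by nlinarith
  have hs20 : 0 < s ^ 2 := by positivity
  have hs4 : s ^ 4 ≤ 1 / 10000 := by nlinarith
  have hs40 : 0 < s ^ 4 := by positivity
  obtain ⟨a, ha, hL⟩ := aux_log 2 (2 * s ^ 2) (by rw [abs_of_pos (by positivity)]; linarith)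
  obtain ⟨c, hc, hY⟩ := aux_log 1 (2 * (2 * s ^ 2) * (1 - 2 * s ^ 2)) (by
    rw [abs_le]; constructor <;> nlinarith)
  simp only [Finset.sum_range_succ, Finset.sum_range_zero] at hL hY
  norm_num at hL hY
  set L := Real.log (1 - 2 * s ^ 2) with hLdef
  have hL' : L = -2 * s ^ 2 - 2 * s ^ 4 + (8 * a) * s ^ 6 := by rw [hL]; ring
  have ha' := abs_le.mp ha
  set w : ℝ := (2 + 2 * s ^ 2 - (8 * a) * s ^ 4) * (1 + s) with hw
  have hx : L * (1 / s) * (1 + s) = -(s * w) := by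
    rw [hL', hw]; field_simp; ring
  have hu0 : 0 < 2 + 2 * s ^ 2 - (8 * a) * s ^ 4 := by nlinarith
  have hu1 : 2 + 2 * s ^ 2 - (8 * a) * s ^ 4 ≤ 2.1 := by nlinarith
  have hw0 : 0 < w := by positivity
  have hw1 : w ≤ 3 := by rw [hw]; nlinarith
  have hsw : s * w ≤ 1 / 2 := by nlinarith
  have hsw0 : 0 < s * w := by positivity
  obtain ⟨b, hb, hX⟩ := aux_log 3 (-(s * w)) (by rw [abs_neg, abs_of_pos hsw0]; exact hsw)
  simp only [Finset.sum_range_succ, Finset.sum_range_zero] at hX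
  norm_num at hX
  rw [hx]
  have hq : 0 < 1 - 2 * s ^ 2 := by linarith
  have hy : 0 < 1 - 2 * (2 * s ^ 2) * (1 - 2 * s ^ 2) := by nlinarith
  have hD : 0 < 1 - -(s * w) := by linarith
  refine ⟨8 * a, b, c, ?_, hb, hc, by positivity, ?_⟩
  · rw [abs_mul]; norm_num; linarith
  rw [one_div, Real.log_mul (by positivity) (by positivity), Real.log_inv, Real.log_rpow (by positivity),
    Real.log_div (by positivity) (by positivity), Real.log_mul (by positivity) (by positivity),
    Real.log_pow, ← hLdef, sub_neg_eq_add, hX, hY, hL', hw]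
  unfold auxR
  push_cast
  ring

theorem stmt_6 :
    ∀ g₁ : ℝ → ℝ,
      (∀ p, g₁ p = (1 / (1 - p)) * ((1 - 2 * p * (1 - p)) /
        ((1 - p) ^ (2:ℕ) * (1 - Real.log (1 - p) * Real.sqrt (2 / p) * (1 + Real.sqrt (p / 2)))))
        ^ (Real.sqrt (p / 2))) →
    (fun p : ℝ => Real.log (g₁ p) - (1 / 3) * p ^ 2)
      =O[nhdsWithin 0 (Set.Ioi 0)] (fun p : ℝ => p ^ ((5:ℝ) / 2)) ∧
    ∀ᶠ p : ℝ in nhdsWithin 0 (Set.Ioi 0), g₁ p > 1 := by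
  intro g hg
  obtain ⟨M, hM0, hM⟩ := auxR_bdd
  have key : ∀ p : ℝ, 0 < p → Real.sqrt (p / 2) ≤ 1 / 10 → 0 < g p ∧
      |Real.log (g p) - (1 / 3) * p ^ 2| ≤ M * Real.sqrt (p / 2) ^ 5 := by
    intro p hp hs1
    have hs : 0 < Real.sqrt (p / 2) := Real.sqrt_pos.mpr (by positivity)
    have hinv : Real.sqrt (2 / p) = 1 / Real.sqrt (p / 2) := by
      rw [one_div, ← Real.sqrt_inv, inv_div]
    have hps : p = 2 * Real.sqrt (p / 2) ^ 2 := by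
      rw [Real.sq_sqrt (by positivity)]; ring
    have hgp := hg p
    rw [hinv] at hgp
    generalize Real.sqrt (p / 2) = s at *
    subst hps
    obtain ⟨a, b, c, ha, hb, hc, h0, h1⟩ := aux_core s hs hs1
    rw [← hgp] at h0 h1
    refine ⟨h0, ?_⟩
    have : Real.log (g (2 * s ^ 2)) - 1 / 3 * (2 * s ^ 2) ^ 2 = s ^ 5 * auxR s a b c := by
      rw [h1]; ring
    rw [this, abs_mul, abs_of_pos (by positivity : 0 < s ^ 5), mul_comm]
    have := hM s a b c (by rw [abs_of_pos hs]; linarith) ha hb hc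
    gcongr
  have hlim : Tendsto (fun p : ℝ => Real.sqrt (p / 2)) (nhdsWithin 0 (Set.Ioi 0)) (nhds 0) := by
    have : Continuous (fun p : ℝ => Real.sqrt (p / 2)) := by fun_prop
    have h := this.tendsto 0
    simp only [zero_div, Real.sqrt_zero] at h
    exact h.mono_left nhdsWithin_le_nhds
  have hpos : ∀ᶠ p : ℝ in nhdsWithin 0 (Set.Ioi 0), 0 < p := self_mem_nhdsWithin
  constructor
  · refine IsBigO.of_bound M ?_
    filter_upwards [hpos, hlim.eventually_le_const (by norm_num : (0:ℝ) < 1 / 10)] with p hp hs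
    refine (key p hp hs).2.trans ?_
    rw [Real.norm_of_nonneg (by positivity)]
    have h1 : p ^ ((5:ℝ) / 2) = Real.sqrt p ^ 5 := by
      rw [Real.sqrt_eq_rpow, ← Real.rpow_natCast, ← Real.rpow_mul hp.le]; norm_num
    rw [h1]
    gcongr
    linarith
  · filter_upwards [hpos, hlim.eventually_le_const (by norm_num : (0:ℝ) < 1 / 10),
      hlim.eventually_le_const (by positivity : (0:ℝ) < 1 / M)] with p hp hs hsM
    obtain ⟨h0, h1⟩ := key p hp hs
    have hs0 : 0 < Real.sqrt (p / 2) := Real.sqrt_pos.mpr (by positivity)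
    have hps : p = 2 * Real.sqrt (p / 2) ^ 2 := by
      rw [Real.sq_sqrt (by positivity)]; ring
    have h2 : M * Real.sqrt (p / 2) ≤ 1 := by
      rw [le_div_iff₀ hM0] at hsM; linarith
    have h3 : p ^ 2 = 4 * Real.sqrt (p / 2) ^ 4 := by
      nth_rewrite 1 [hps]; ring
    have h4 : 0 < Real.sqrt (p / 2) ^ 4 := by positivity
    have h5 := (abs_le.mp h1).1
    have h6 : 0 < Real.log (g p) := by
      have : M * Real.sqrt (p / 2) ^ 5 = (M * Real.sqrt (p / 2)) * Real.sqrt (p / 2) ^ 4 := by ring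
      nlinarith
    exact (Real.log_pos_iff h0.le).mp h6
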